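/- Let Q be a relatively congruence-distributive quasivariety such that Q_RFSI is closed under substructures. Then the following are equivalent: (1) Q has the Q-congruence extension property; (2) Q has the extension property; (3) Q_RFSI has the Q-congruence extension property; (4) Q_RFSI has the extension property. -/

import Mathlib

open FirstOrder Language Set

universe u

namespace Transfer

variable (L : FirstOrder.Language.{u, u})

/-- A bundled `L`-structure with carrier in universe `u`. -/
structure Struc : Type (u + 1) where
  Carrier : Type u
  [str : L.Structure Carrier]

attribute [instance] Struc.str

/-- Product structure on a Pi type. -/
instance piStructure {ι : Type u} (M : ι → Type u) [∀ i, L.Structure (M i)] :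
    L.Structure (∀ i, M i) where
  funMap f x i := Structure.funMap f fun j => x j i
  RelMap r x := ∀ i, Structure.RelMap r fun j => x j i

/-- Product structure on a binary product. -/
instance prodStructure (M N : Type u) [L.Structure M] [L.Structure N] :
    L.Structure (M × N) where
  funMap f x := (Structure.funMap f fun j => (x j).1, Structure.funMap f fun j => (x j).2)
  RelMap r x := Structure.RelMap r (fun j => (x j).1) ∧ Structure.RelMap r (fun j => (x j).2)

variable {L}

/-- The bundled structure on a substructure. -/
abbrev ofSub (B : Struc L) (S : L.Substructure B.Carrier) : Struc L := ⟨S⟩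

/-- The kernel of a map, as a set of pairs. -/
def kerSet {α β : Type u} (f : α → β) : Set (α × α) := {p | f p.1 = f p.2}

/-- The restriction of a binary relation on `B` to a substructure `S`. -/
def restrict {B : Struc L} (S : L.Substructure B.Carrier)
    (Θ : Set (B.Carrier × B.Carrier)) : Set ((ofSub B S).Carrier × (ofSub B S).Carrier) :=
  {p | ((p.1 : B.Carrier), (p.2 : B.Carrier)) ∈ Θ}

/-- The image of a binary relation on a substructure `S` in `B`. -/
def lift {B : Struc L} (S : L.Substructure B.Carrier)
    (Θ : Set ((ofSub B S).Carrier × (ofSub B S).Carrier)) : Set (B.Carrier × B.Carrier) :=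
  (fun p => ((p.1 : B.Carrier), (p.2 : B.Carrier))) '' Θ

/-- The set of `Q`-congruences of `A`: kernels of homomorphisms into members of `Q`. -/
def ConQ (Q : Set (Struc L)) (A : Struc L) : Set (Set (A.Carrier × A.Carrier)) :=
  {θ | ∃ M ∈ Q, ∃ f : A.Carrier →[L] M.Carrier, θ = kerSet f}

/-- The least `Q`-congruence of `A` containing `R`. -/
def cgQ (Q : Set (Struc L)) (A : Struc L) (R : Set (A.Carrier × A.Carrier)) :
    Set (A.Carrier × A.Carrier) :=
  ⋂₀ {θ | θ ∈ ConQ Q A ∧ R ⊆ θ}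

/-- The join of two `Q`-congruences in `Con_Q A`. -/
def joinQ (Q : Set (Struc L)) (A : Struc L) (θ φ : Set (A.Carrier × A.Carrier)) :
    Set (A.Carrier × A.Carrier) :=
  cgQ Q A (θ ∪ φ)

/-- `θ` is a meet-irreducible element of `Con_Q A`. -/
def MeetIrred (Q : Set (Struc L)) (A : Struc L) (θ : Set (A.Carrier × A.Carrier)) : Prop :=
  θ ∈ ConQ Q A ∧
    ∀ θ₁ ∈ ConQ Q A, ∀ θ₂ ∈ ConQ Q A, θ = θ₁ ∩ θ₂ → θ = θ₁ ∨ θ = θ₂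

/-- `θ` is a completely meet-irreducible element of `Con_Q A`. -/
def CompletelyMeetIrred (Q : Set (Struc L)) (A : Struc L)
    (θ : Set (A.Carrier × A.Carrier)) : Prop :=
  θ ∈ ConQ Q A ∧
    ∀ S ⊆ ConQ Q A, θ = ⋂₀ S → θ ∈ S

/-- The class of relatively finitely subdirectly irreducible members of `Q`. -/
def RFSI (Q : Set (Struc L)) : Set (Struc L) :=
  {A | A ∈ Q ∧ MeetIrred Q A (Set.diagonal A.Carrier)}

/-- The class of relatively subdirectly irreducible members of `Q`. -/
def RSI (Q : Set (Struc L)) : Set (Struc L) :=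
  {A | A ∈ Q ∧ CompletelyMeetIrred Q A (Set.diagonal A.Carrier)}

/-- `B` has the `Q`-congruence extension property. -/
def HasQCEP (Q : Set (Struc L)) (B : Struc L) : Prop :=
  ∀ S : L.Substructure B.Carrier, ∀ θ ∈ ConQ Q (ofSub B S),
    ∃ Φ ∈ ConQ Q B, restrict S Φ = θ

/-- A class `K` of members of `Q` has the `Q`-congruence extension property. -/
def ClassQCEP (Q K : Set (Struc L)) : Prop :=
  ∀ B ∈ K, HasQCEP Q B

variable (L)

/-- `Q` is a quasivariety: closed under isomorphisms, substructures, direct products,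
and ultraproducts. -/
def IsQuasivariety (Q : Set (Struc L)) : Prop :=
  (∀ A ∈ Q, ∀ B : Struc L, Nonempty (A.Carrier ≃[L] B.Carrier) → B ∈ Q) ∧
  (∀ B ∈ Q, ∀ S : L.Substructure B.Carrier, ofSub B S ∈ Q) ∧
  (∀ (ι : Type u) (f : ι → Struc L), (∀ i, f i ∈ Q) →
    (⟨∀ i, (f i).Carrier⟩ : Struc L) ∈ Q) ∧
  (∀ (ι : Type u) (f : ι → Struc L) (U : Ultrafilter ι), (∀ i, f i ∈ Q) →
    (⟨(U : Filter ι).Product fun i => (f i).Carrier⟩ : Struc L) ∈ Q)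

/-- `V` is a variety: closed under homomorphic images, substructures, and direct products. -/
def IsVariety (V : Set (Struc L)) : Prop :=
  (∀ A ∈ V, ∀ B : Struc L, ∀ f : A.Carrier →[L] B.Carrier, Function.Surjective f → B ∈ V) ∧
  (∀ B ∈ V, ∀ S : L.Substructure B.Carrier, ofSub B S ∈ V) ∧
  (∀ (ι : Type u) (f : ι → Struc L), (∀ i, f i ∈ V) →
    (⟨∀ i, (f i).Carrier⟩ : Struc L) ∈ V)

variable {L}

/-- `Q` is relatively congruence-distributive: `Con_Q A` is a distributive lattice
for every `A ∈ Q`. -/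
def RelCongDist (Q : Set (Struc L)) : Prop :=
  ∀ A ∈ Q, ∀ θ ∈ ConQ Q A, ∀ φ ∈ ConQ Q A, ∀ ψ ∈ ConQ Q A,
    θ ∩ joinQ Q A φ ψ = joinQ Q A (θ ∩ φ) (θ ∩ ψ)

/-- Relation composition `Θ ∘ Φ = {(a,c) : ∃ b, (a,b) ∈ Φ ∧ (b,c) ∈ Θ}`. -/
def relComp {α : Type u} (Θ Φ : Set (α × α)) : Set (α × α) :=
  {p | ∃ b, (p.1, b) ∈ Φ ∧ (b, p.2) ∈ Θ}

/-- `Q` is relatively congruence-permutable. -/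
def RelCongPerm (Q : Set (Struc L)) : Prop :=
  ∀ A ∈ Q, ∀ θ ∈ ConQ Q A, ∀ φ ∈ ConQ Q A, relComp θ φ = relComp φ θ

/-- A class `K` is closed under substructures. -/
def SubClosed (K : Set (Struc L)) : Prop :=
  ∀ B ∈ K, ∀ S : L.Substructure B.Carrier, ofSub B S ∈ K

/-- A class `K` is closed under isomorphisms. -/
def IsoClosed (K : Set (Struc L)) : Prop :=
  ∀ A ∈ K, ∀ B : Struc L, Nonempty (A.Carrier ≃[L] B.Carrier) → B ∈ K

/-- A universal class: closed under isomorphisms, substructures, and ultraproducts. -/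
def IsUniversalClass (K : Set (Struc L)) : Prop :=
  IsoClosed K ∧ SubClosed K ∧
  (∀ (ι : Type u) (f : ι → Struc L) (U : Ultrafilter ι), (∀ i, f i ∈ K) →
    (⟨(U : Filter ι).Product fun i => (f i).Carrier⟩ : Struc L) ∈ K)

/-- The extension property for a class `K`. -/
def HasEP (K : Set (Struc L)) : Prop :=
  ∀ A ∈ K, ∀ B ∈ K, ∀ C ∈ K,
    ∀ (φB : A.Carrier →[L] B.Carrier) (φC : A.Carrier →[L] C.Carrier),
      Function.Injective φB → Function.Surjective φC →
      ∃ D ∈ K, ∃ (ψB : B.Carrier →[L] D.Carrier) (ψC : C.Carrier →[L] D.Carrier),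
        Function.Injective ψC ∧ ∀ a, ψB (φB a) = ψC (φC a)

/-- The one-sided amalgamation property for a class `K`. -/
def Has1AP (K : Set (Struc L)) : Prop :=
  ∀ A ∈ K, ∀ B ∈ K, ∀ C ∈ K,
    ∀ (φB : A.Carrier →[L] B.Carrier) (φC : A.Carrier →[L] C.Carrier),
      Function.Injective φB → Function.Injective φC →
      ∃ D ∈ K, ∃ (ψB : B.Carrier →[L] D.Carrier) (ψC : C.Carrier →[L] D.Carrier),
        Function.Injective ψC ∧ ∀ a, ψB (φB a) = ψC (φC a)

/-- Every doubly injective span in `K` has an amalgam in `K'`. -/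
def HasAmalgamIn (K K' : Set (Struc L)) : Prop :=
  ∀ A ∈ K, ∀ B ∈ K, ∀ C ∈ K,
    ∀ (φB : A.Carrier →[L] B.Carrier) (φC : A.Carrier →[L] C.Carrier),
      Function.Injective φB → Function.Injective φC →
      ∃ D ∈ K', ∃ (ψB : B.Carrier →[L] D.Carrier) (ψC : C.Carrier →[L] D.Carrier),
        Function.Injective ψB ∧ Function.Injective ψC ∧ ∀ a, ψB (φB a) = ψC (φC a)

/-- The amalgamation property for a class `K`. -/
def HasAP (K : Set (Struc L)) : Prop := HasAmalgamIn K K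

/-- The transferable injections property for a class `K`. -/
def HasTIP (K : Set (Struc L)) : Prop :=
  ∀ A ∈ K, ∀ B ∈ K, ∀ C ∈ K,
    ∀ (φB : A.Carrier →[L] B.Carrier) (φC : A.Carrier →[L] C.Carrier),
      Function.Injective φB →
      ∃ D ∈ K, ∃ (ψB : B.Carrier →[L] D.Carrier) (ψC : C.Carrier →[L] D.Carrier),
        Function.Injective ψC ∧ ∀ a, ψB (φB a) = ψC (φC a)

/-- Every doubly injective span in `K` has a strong amalgam in `K'`. -/
def HasStrongAmalgamIn (K K' : Set (Struc L)) : Prop :=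
  ∀ A ∈ K, ∀ B ∈ K, ∀ C ∈ K,
    ∀ (φB : A.Carrier →[L] B.Carrier) (φC : A.Carrier →[L] C.Carrier),
      Function.Injective φB → Function.Injective φC →
      ∃ D ∈ K', ∃ (ψB : B.Carrier →[L] D.Carrier) (ψC : C.Carrier →[L] D.Carrier),
        Function.Injective ψB ∧ Function.Injective ψC ∧ (∀ a, ψB (φB a) = ψC (φC a)) ∧
        Set.range (fun a => ψB (φB a)) = Set.range ψB ∩ Set.range ψC

/-- The strong amalgamation property for a class `K`. -/
def HasSAP (K : Set (Struc L)) : Prop := HasStrongAmalgamIn K K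

/-- `φ : A → B` is an epimorphism in the class `K`. -/
def IsEpiIn (K : Set (Struc L)) {A B : Struc L} (φ : A.Carrier →[L] B.Carrier) : Prop :=
  ∀ C ∈ K, ∀ ψ₁ ψ₂ : B.Carrier →[L] C.Carrier,
    ψ₁.comp φ = ψ₂.comp φ → ψ₁ = ψ₂

/-- The class `K` has surjective epimorphisms. -/
def HasSE (K : Set (Struc L)) : Prop :=
  ∀ A ∈ K, ∀ B ∈ K, ∀ φ : A.Carrier →[L] B.Carrier,
    IsEpiIn K φ → Function.Surjective φ

/-- A substructure `S` of `B` is a retract of `B`. -/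
def IsRetract (B : Struc L) (S : L.Substructure B.Carrier) : Prop :=
  ∃ ψ : B.Carrier →[L] (ofSub B S).Carrier, ∀ a : (ofSub B S).Carrier, ψ (a : B.Carrier) = a


/-- The smallest variety containing `V₁ ∪ V₂`. -/
def varJoin (L : FirstOrder.Language.{u, u}) (V₁ V₂ : Set (Struc L)) : Set (Struc L) :=
  ⋂₀ {W | IsVariety L W ∧ V₁ ⊆ W ∧ V₂ ⊆ W}

theorem mem_ConQ_kerSet {L : FirstOrder.Language.{u, u}} {Q : Set (Struc L)} {A M : Struc L}
    (hM : M ∈ Q) (f : A.Carrier →[L] M.Carrier) : kerSet f ∈ ConQ Q A :=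
  ⟨M, hM, f, rfl⟩

/-- Pulling a `Q`-congruence back along a homomorphism gives a `Q`-congruence. -/
theorem ConQ_preimage {L : FirstOrder.Language.{u, u}} {Q : Set (Struc L)} {A B : Struc L}
    (f : A.Carrier →[L] B.Carrier) {Φ : Set (B.Carrier × B.Carrier)} (hΦ : Φ ∈ ConQ Q B) :
    {p : A.Carrier × A.Carrier | (f p.1, f p.2) ∈ Φ} ∈ ConQ Q A := by
  obtain ⟨M, hM, g, rfl⟩ := hΦ
  exact ⟨M, hM, g.comp f, rfl⟩

theorem restrict_mem_ConQ {L : FirstOrder.Language.{u, u}} {Q : Set (Struc L)} {B : Struc L}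
    (S : L.Substructure B.Carrier) {Φ : Set (B.Carrier × B.Carrier)} (hΦ : Φ ∈ ConQ Q B) :
    restrict S Φ ∈ ConQ Q (ofSub B S) :=
  ConQ_preimage (A := ofSub B S) S.subtype.toHom hΦ

/-- A homomorphism factors through every surjective homomorphism with a smaller kernel. -/
theorem exists_hom_factor {L : FirstOrder.Language.{u, u}} [L.IsAlgebraic] {A B M : Type u}
    [L.Structure A] [L.Structure B] [L.Structure M] (f : A →[L] B) (g : A →[L] M)
    (hf : Function.Surjective f) (h : ∀ a a', f a = f a' → g a = g a') :
    ∃ k : B →[L] M, ∀ a, k (f a) = g a := by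
  have hk : ∀ a, g (Function.surjInv hf (f a)) = g a := fun a =>
    h _ _ (Function.surjInv_eq hf _)
  refine ⟨⟨fun b => g (Function.surjInv hf b), ?_, fun r => isEmptyElim r⟩, hk⟩
  intro n F x
  have hx : x = f ∘ fun i => Function.surjInv hf (x i) :=
    funext fun i => (Function.surjInv_eq hf _).symm
  conv_lhs => rw [hx, ← f.map_fun, hk, g.map_fun]
  rfl

theorem sInter_mem_ConQ {L : FirstOrder.Language.{u, u}} [L.IsAlgebraic] {Q : Set (Struc L)}
    (hQ : IsQuasivariety L Q) {A : Struc L} {S : Set (Set (A.Carrier × A.Carrier))}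
    (hS : S ⊆ ConQ Q A) : ⋂₀ S ∈ ConQ Q A := by
  choose M hM f hf using fun θ : S => hS θ.2
  refine ⟨_, hQ.2.2.1 S M hM,
    ⟨fun a θ => f θ a, fun F x => funext fun θ => (f θ).map_fun F x, fun r => isEmptyElim r⟩, ?_⟩
  ext p
  constructor
  · intro hp
    refine funext fun θ => ?_
    have := hp θ.1 θ.2
    rw [hf θ] at this
    exact this
  · intro hp θ hθ
    have h := congrFun hp ⟨θ, hθ⟩
    have e := hf ⟨θ, hθ⟩
    dsimp only at e
    rw [e]
    exact h

/-- The union of a nonempty chain of `Q`-congruences is a `Q`-congruence. -/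
theorem sUnion_mem_ConQ {L : FirstOrder.Language.{u, u}} [L.IsAlgebraic] {Q : Set (Struc L)}
    (hQ : IsQuasivariety L Q) {A : Struc L} {S : Set (Set (A.Carrier × A.Carrier))}
    (hS : S ⊆ ConQ Q A) (hc : IsChain (· ⊆ ·) S) (hne : S.Nonempty) : ⋃₀ S ∈ ConQ Q A := by
  choose M hM f hf using fun θ : S => hS θ.2
  have : Nonempty S := hne.to_subtype
  have : IsDirectedOrder S := ⟨fun a b => by
    rcases hc.total a.2 b.2 with h | h
    · exact ⟨b, h, le_rfl⟩
    · exact ⟨a, le_rfl, h⟩⟩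
  let U : Ultrafilter S := Ultrafilter.of Filter.atTop
  have hU : (U : Filter S) ≤ Filter.atTop := Ultrafilter.of_le _
  refine ⟨_, hQ.2.2.2 S M U hM,
    ⟨fun a => ((fun θ => f θ a : ∀ θ, (M θ).Carrier) :
        (U : Filter S).Product fun θ => (M θ).Carrier), ?_, fun r => isEmptyElim r⟩, ?_⟩
  · intro n F x
    refine Eq.trans ?_ (Ultraproduct.funMap_cast (u := U) F fun i θ => f θ (x i)).symm
    exact congrArg _ (funext fun θ => (f θ).map_fun F x)
  · ext p
    have key : p ∈ ⋃₀ S ↔ ∀ᶠ θ in (U : Filter S), f θ p.1 = f θ p.2 := by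
      have hp : ∀ θ : S, p ∈ θ.1 ↔ f θ p.1 = f θ p.2 := fun θ => by
        have e := hf θ
        exact (Set.ext_iff.mp e p)
      constructor
      · rintro ⟨θ, hθ, h⟩
        filter_upwards [hU (Filter.mem_atTop (⟨θ, hθ⟩ : S))] with φ hφ
        exact (hp φ).1 (hφ h)
      · intro h
        obtain ⟨θ, hθ⟩ := h.exists
        exact ⟨θ, θ.2, (hp θ).2 hθ⟩
    rw [key]
    exact ⟨fun h => Quotient.sound h, fun h => Quotient.exact h⟩

/-- Zorn's lemma for `Q`-congruences. -/
theorem exists_maximal_ConQ {L : FirstOrder.Language.{u, u}} [L.IsAlgebraic] {Q : Set (Struc L)}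
    (hQ : IsQuasivariety L Q) {A : Struc L} (P : Set (A.Carrier × A.Carrier) → Prop)
    (hP : ∀ S : Set (Set (A.Carrier × A.Carrier)), IsChain (· ⊆ ·) S → S.Nonempty →
      (∀ θ ∈ S, P θ) → P (⋃₀ S))
    {θ : Set (A.Carrier × A.Carrier)} (hθ : θ ∈ ConQ Q A) (hPθ : P θ) :
    ∃ Φ ∈ ConQ Q A, P Φ ∧ θ ⊆ Φ ∧ ∀ Ψ ∈ ConQ Q A, P Ψ → Φ ⊆ Ψ → Φ = Ψ := by
  obtain ⟨m, hm, hmax⟩ := zorn_subset_nonempty {Φ | Φ ∈ ConQ Q A ∧ P Φ}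
    (fun c hc hchain hne => ⟨⋃₀ c,
      ⟨sUnion_mem_ConQ hQ (fun x hx => (hc hx).1) hchain hne,
        hP c hchain hne fun x hx => (hc hx).2⟩,
      fun s hs => Set.subset_sUnion_of_mem hs⟩) θ ⟨hθ, hPθ⟩
  exact ⟨m, hmax.1.1, hmax.1.2, hm, fun Ψ hΨ hPΨ h => hmax.eq_of_subset ⟨hΨ, hPΨ⟩ h⟩

/-- Every pair outside a `Q`-congruence `θ` is omitted by a meet-irreducible `Q`-congruence
above `θ`. -/
theorem exists_meetIrred_of_notMem {L : FirstOrder.Language.{u, u}} [L.IsAlgebraic]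
    {Q : Set (Struc L)} (hQ : IsQuasivariety L Q) {A : Struc L}
    {θ : Set (A.Carrier × A.Carrier)} (hθ : θ ∈ ConQ Q A) {p : A.Carrier × A.Carrier}
    (hp : p ∉ θ) : ∃ φ, MeetIrred Q A φ ∧ θ ⊆ φ ∧ p ∉ φ := by
  obtain ⟨φ, hφ, hpφ, hle, hmax⟩ := exists_maximal_ConQ hQ (fun φ => p ∉ φ)
    (by rintro S - - h ⟨t, ht, hpt⟩; exact h t ht hpt) hθ hp
  refine ⟨φ, ⟨hφ, fun φ₁ h₁ φ₂ h₂ e => ?_⟩, hle, hpφ⟩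
  by_cases hp1 : p ∈ φ₁
  · right
    refine hmax φ₂ h₂ (fun hp2 => hpφ ?_) (e ▸ Set.inter_subset_right)
    rw [e]
    exact ⟨hp1, hp2⟩
  · left
    exact hmax φ₁ h₁ hp1 (e ▸ Set.inter_subset_left)

/-- `Q`-congruences have extensions to `B` as soon as the meet-irreducible ones do. -/
theorem hasQCEP_of_meetIrred {L : FirstOrder.Language.{u, u}} [L.IsAlgebraic]
    {Q : Set (Struc L)} (hQ : IsQuasivariety L Q) {B : Struc L}
    (h : ∀ S : L.Substructure B.Carrier, ∀ θ, MeetIrred Q (ofSub B S) θ →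
      ∃ Φ ∈ ConQ Q B, restrict S Φ = θ) : HasQCEP Q B := by
  intro S θ hθ
  refine ⟨⋂₀ {Φ | Φ ∈ ConQ Q B ∧ θ ⊆ restrict S Φ}, sInter_mem_ConQ hQ fun Φ hΦ => hΦ.1, ?_⟩
  refine Set.Subset.antisymm (fun p hp => ?_) fun p hp Φ hΦ => hΦ.2 hp
  by_contra hpθ
  obtain ⟨φ, hφ, hle, hpφ⟩ := exists_meetIrred_of_notMem hQ hθ hpθ
  obtain ⟨Φ, hΦ, rfl⟩ := h S φ hφ
  exact hpφ (hp Φ ⟨hΦ, hle⟩)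

/-- The quotient by a meet-irreducible `Q`-congruence is relatively finitely subdirectly
irreducible. -/
theorem exists_RFSI_quotient {L : FirstOrder.Language.{u, u}} {Q : Set (Struc L)}
    (hQ : IsQuasivariety L Q) {A : Struc L} {θ : Set (A.Carrier × A.Carrier)}
    (hθ : MeetIrred Q A θ) :
    ∃ D ∈ RFSI Q, ∃ f : A.Carrier →[L] D.Carrier, Function.Surjective f ∧ θ = kerSet f := by
  obtain ⟨⟨M, hM, g, rfl⟩, hirr⟩ := hθ
  let D : Struc L := ofSub M g.range
  have hD : D ∈ Q := hQ.2.1 M hM _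
  let f : A.Carrier →[L] D.Carrier := g.codRestrict g.range fun a => ⟨a, rfl⟩
  have hf : Function.Surjective f := by
    rintro ⟨_, a, rfl⟩
    exact ⟨a, rfl⟩
  have hker : kerSet g = kerSet f := by
    ext p
    exact ⟨fun h => Subtype.ext h, fun h => congrArg Subtype.val h⟩
  refine ⟨D, ⟨hD, ⟨D, hD, Hom.id L _, rfl⟩, ?_⟩, f, hf, hker⟩
  intro θ₁ h₁ θ₂ h₂ e
  have pull : ∀ φ : Set (D.Carrier × D.Carrier),
      kerSet g = {p | (f p.1, f p.2) ∈ φ} → Set.diagonal D.Carrier = φ := by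
    intro φ hφ
    ext ⟨x, y⟩
    obtain ⟨a, rfl⟩ := hf x
    obtain ⟨b, rfl⟩ := hf y
    exact Set.ext_iff.mp (hker.symm.trans hφ) (a, b)
  refine (hirr _ (ConQ_preimage f h₁) _ (ConQ_preimage f h₂) ?_).imp (pull _) (pull _)
  ext p
  rw [hker]
  exact Set.ext_iff.mp e (f p.1, f p.2)

/-- The kernel of a surjective homomorphism onto a relatively finitely subdirectly irreducible
algebra is meet-irreducible. -/
theorem meetIrred_kerSet {L : FirstOrder.Language.{u, u}} [L.IsAlgebraic] {Q : Set (Struc L)}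
    {A C : Struc L} (hC : C ∈ RFSI Q) (f : A.Carrier →[L] C.Carrier)
    (hf : Function.Surjective f) : MeetIrred Q A (kerSet f) := by
  refine ⟨mem_ConQ_kerSet hC.1 f, ?_⟩
  rintro _ ⟨M₁, hM₁, g₁, rfl⟩ _ ⟨M₂, hM₂, g₂, rfl⟩ e
  obtain ⟨k₁, hk₁⟩ := exists_hom_factor f g₁ hf fun a b h =>
    ((Set.ext_iff.mp e (a, b)).1 h).1
  obtain ⟨k₂, hk₂⟩ := exists_hom_factor f g₂ hf fun a b h =>
    ((Set.ext_iff.mp e (a, b)).1 h).2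
  have pull : ∀ (M : Struc L) (g : A.Carrier →[L] M.Carrier) (k : C.Carrier →[L] M.Carrier),
      (∀ a, k (f a) = g a) → Set.diagonal C.Carrier = kerSet k → kerSet f = kerSet g := by
    intro M g k hk h
    ext ⟨a, b⟩
    have := Set.ext_iff.mp h (f a, f b)
    change f a = f b ↔ k (f a) = k (f b) at this
    rwa [hk, hk] at this
  refine (hC.2.2 _ (mem_ConQ_kerSet hM₁ k₁) _ (mem_ConQ_kerSet hM₂ k₂) ?_).imp
    (pull _ _ _ hk₁) (pull _ _ _ hk₂)
  ext ⟨x, y⟩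
  obtain ⟨a, rfl⟩ := hf x
  obtain ⟨b, rfl⟩ := hf y
  have := Set.ext_iff.mp e (a, b)
  change f a = f b ↔ g₁ a = g₁ b ∧ g₂ a = g₂ b at this
  rw [← hk₁, ← hk₁, ← hk₂, ← hk₂] at this
  exact this

/-- Congruence extension along an arbitrary homomorphism `j` into an algebra with the
`Q`-congruence extension property. -/
theorem HasQCEP.exists_extension {L : FirstOrder.Language.{u, u}} [L.IsAlgebraic]
    {Q : Set (Struc L)} {A B N : Struc L} (hB : HasQCEP Q B) (hN : N ∈ Q)
    (j : A.Carrier →[L] B.Carrier) (g : A.Carrier →[L] N.Carrier)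
    (h : ∀ a a', j a = j a' → g a = g a') :
    ∃ Φ ∈ ConQ Q B, ∀ a a', (j a, j a') ∈ Φ ↔ g a = g a' := by
  let f : A.Carrier →[L] j.range := j.codRestrict j.range fun a => ⟨a, rfl⟩
  have hf : Function.Surjective f := by
    rintro ⟨_, a, rfl⟩
    exact ⟨a, rfl⟩
  obtain ⟨k, hk⟩ := exists_hom_factor f g hf fun a a' e => h a a' (Subtype.ext_iff.mp e)
  obtain ⟨Φ, hΦ, e⟩ := hB j.range (kerSet k) (mem_ConQ_kerSet (A := ofSub B j.range) hN k)
  refine ⟨Φ, hΦ, fun a a' => ?_⟩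
  have := Set.ext_iff.mp e (f a, f a')
  change (j a, j a') ∈ Φ ↔ k (f a) = k (f a') at this
  rwa [hk, hk] at this

/-- A homomorphism on `B` whose kernel extends that of `φC` completes the span. -/
theorem exists_completion {L : FirstOrder.Language.{u, u}} [L.IsAlgebraic] {A B C D : Struc L}
    (φB : A.Carrier →[L] B.Carrier) (φC : A.Carrier →[L] C.Carrier)
    (hC : Function.Surjective φC) (f : B.Carrier →[L] D.Carrier)
    (h : ∀ a a', f (φB a) = f (φB a') ↔ φC a = φC a') :
    ∃ ψC : C.Carrier →[L] D.Carrier,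
      Function.Injective ψC ∧ ∀ a, f (φB a) = ψC (φC a) := by
  obtain ⟨k, hk⟩ := exists_hom_factor φC (f.comp φB) hC fun a a' e => (h a a').2 e
  refine ⟨k, fun x y e => ?_, fun a => (hk a).symm⟩
  obtain ⟨a, rfl⟩ := hC x
  obtain ⟨b, rfl⟩ := hC y
  rw [hk, hk] at e
  exact (h a b).1 e

theorem HasEP.of_classQCEP {L : FirstOrder.Language.{u, u}} [L.IsAlgebraic] {Q : Set (Struc L)}
    (h : ClassQCEP Q Q) : HasEP Q := by
  intro A _ B hB C hC φB φC hi hsurj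
  obtain ⟨_, ⟨D, hD, f, rfl⟩, hf⟩ := (h B hB).exists_extension hC φB φC
    fun a a' e => congrArg φC (hi e)
  exact ⟨D, hD, f, exists_completion φB φC hsurj f hf⟩

theorem HasEP.of_classQCEP_RFSI {L : FirstOrder.Language.{u, u}} [L.IsAlgebraic]
    {Q : Set (Struc L)} (hQ : IsQuasivariety L Q) (h : ClassQCEP Q (RFSI Q)) :
    HasEP (RFSI Q) := by
  intro A _ B hB C hC φB φC hi hsurj
  obtain ⟨Φ₀, hΦ₀, hext₀⟩ := (h B hB).exists_extension hC.1 φB φC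
    fun a a' e => congrArg φC (hi e)
  have hker := meetIrred_kerSet hC φC hsurj
  obtain ⟨Φ, hΦ, hext, -, hmax⟩ := exists_maximal_ConQ hQ
    (fun Φ => kerSet φC = {p | (φB p.1, φB p.2) ∈ Φ})
    (by
      rintro S - ⟨s, hs⟩ hS
      refine Set.Subset.antisymm (fun p hp => ⟨s, hs, ?_⟩) ?_
      · rw [hS s hs] at hp
        exact hp
      · rintro p ⟨t, ht, hp⟩
        rw [hS t ht]
        exact hp)
    hΦ₀ (Set.ext fun p => (hext₀ p.1 p.2).symm)
  have hirr : MeetIrred Q B Φ := by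
    refine ⟨hΦ, fun Φ₁ h₁ Φ₂ h₂ e => ?_⟩
    refine (hker.2 _ (ConQ_preimage φB h₁) _ (ConQ_preimage φB h₂) ?_).imp
      (fun h' => hmax _ h₁ h' (e ▸ Set.inter_subset_left))
      (fun h' => hmax _ h₂ h' (e ▸ Set.inter_subset_right))
    rw [hext, e]
    rfl
  obtain ⟨D, hD, f, -, rfl⟩ := exists_RFSI_quotient hQ hirr
  exact ⟨D, hD, f, exists_completion φB φC hsurj f
    fun a a' => (Set.ext_iff.mp hext (a, a')).symm⟩

theorem HasEP.classQCEP {L : FirstOrder.Language.{u, u}} [L.IsAlgebraic] {Q K : Set (Struc L)}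
    (hQ : IsQuasivariety L Q) (hKQ : K ⊆ Q) (hRK : RFSI Q ⊆ K) (hs : SubClosed K)
    (h : HasEP K) : ClassQCEP Q K := by
  intro B hB
  refine hasQCEP_of_meetIrred hQ fun S θ hθ => ?_
  obtain ⟨C, hC, f, hf, rfl⟩ := exists_RFSI_quotient hQ hθ
  obtain ⟨D, hD, ψB, ψC, hψ, hcomm⟩ := h (ofSub B S) (hs B hB S) B hB C (hRK hC)
    S.subtype.toHom f Subtype.val_injective hf
  refine ⟨kerSet ψB, mem_ConQ_kerSet (hKQ hD) ψB, ?_⟩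
  ext ⟨a, b⟩
  change ψB (S.subtype.toHom a) = ψB (S.subtype.toHom b) ↔ f a = f b
  rw [hcomm, hcomm, hψ.eq_iff]

theorem subset_joinQ_left {L : FirstOrder.Language.{u, u}} {Q : Set (Struc L)} {A : Struc L}
    (θ φ : Set (A.Carrier × A.Carrier)) : θ ⊆ joinQ Q A θ φ :=
  fun _ hp _ hψ => hψ.2 (Or.inl hp)

theorem subset_joinQ_right {L : FirstOrder.Language.{u, u}} {Q : Set (Struc L)} {A : Struc L}
    (θ φ : Set (A.Carrier × A.Carrier)) : φ ⊆ joinQ Q A θ φ :=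
  fun _ hp _ hψ => hψ.2 (Or.inr hp)

theorem joinQ_subset {L : FirstOrder.Language.{u, u}} {Q : Set (Struc L)} {A : Struc L}
    {θ φ ψ : Set (A.Carrier × A.Carrier)} (hψ : ψ ∈ ConQ Q A) (h₁ : θ ⊆ ψ) (h₂ : φ ⊆ ψ) :
    joinQ Q A θ φ ⊆ ψ :=
  Set.sInter_subset_of_mem ⟨hψ, Set.union_subset h₁ h₂⟩

theorem joinQ_mem_ConQ {L : FirstOrder.Language.{u, u}} [L.IsAlgebraic] {Q : Set (Struc L)}
    (hQ : IsQuasivariety L Q) {A : Struc L} (θ φ : Set (A.Carrier × A.Carrier)) :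
    joinQ Q A θ φ ∈ ConQ Q A :=
  sInter_mem_ConQ hQ fun _ h => h.1

/-- By distributivity, meet-irreducible `Q`-congruences are meet-prime. -/
theorem MeetIrred.meetPrime {L : FirstOrder.Language.{u, u}} [L.IsAlgebraic] {Q : Set (Struc L)}
    (hQ : IsQuasivariety L Q) (hd : RelCongDist Q) {A : Struc L} (hA : A ∈ Q)
    {θ φ₁ φ₂ : Set (A.Carrier × A.Carrier)} (hθ : MeetIrred Q A θ) (h₁ : φ₁ ∈ ConQ Q A)
    (h₂ : φ₂ ∈ ConQ Q A) (h : φ₁ ∩ φ₂ ⊆ θ) : φ₁ ⊆ θ ∨ φ₂ ⊆ θ := by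
  have hj₁ := joinQ_mem_ConQ hQ θ φ₁
  have hj₂ := joinQ_mem_ConQ hQ θ φ₂
  have e : θ = joinQ Q A θ φ₁ ∩ joinQ Q A θ φ₂ := by
    refine Set.Subset.antisymm
      (Set.subset_inter (subset_joinQ_left _ _) (subset_joinQ_left _ _)) ?_
    rw [hd A hA _ hj₁ θ hθ.1 φ₂ h₂]
    refine joinQ_subset hθ.1 Set.inter_subset_right ?_
    rw [Set.inter_comm, hd A hA φ₂ h₂ θ hθ.1 φ₁ h₁]
    refine joinQ_subset hθ.1 Set.inter_subset_right ?_
    rwa [Set.inter_comm]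
  refine (hθ.2 _ hj₁ _ hj₂ e).imp (fun h' => ?_) fun h' => ?_
  · exact (subset_joinQ_right θ φ₁).trans h'.ge
  · exact (subset_joinQ_right θ φ₂).trans h'.ge

theorem ClassQCEP.of_RFSI {L : FirstOrder.Language.{u, u}} [L.IsAlgebraic] {Q : Set (Struc L)}
    (hQ : IsQuasivariety L Q) (hd : RelCongDist Q) (h : ClassQCEP Q (RFSI Q)) :
    ClassQCEP Q Q := by
  intro B hB
  refine hasQCEP_of_meetIrred hQ fun S θ hθ => ?_
  have hdiag : Set.diagonal B.Carrier ∈ ConQ Q B := ⟨B, hB, Hom.id L _, rfl⟩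
  have hrefl : restrict S (Set.diagonal B.Carrier) ⊆ θ := by
    obtain ⟨N, -, g, rfl⟩ := hθ.1
    intro p hp
    exact congrArg g (Subtype.ext hp)
  obtain ⟨Φ, hΦ, hle, -, hmax⟩ := exists_maximal_ConQ hQ (fun Φ => restrict S Φ ⊆ θ)
    (by rintro T - - hT p ⟨t, ht, hp⟩; exact hT t ht hp) hdiag hrefl
  have hirr : MeetIrred Q B Φ := by
    refine ⟨hΦ, fun Φ₁ h₁ Φ₂ h₂ e => ?_⟩
    refine (hθ.meetPrime hQ hd (hQ.2.1 B hB S) (restrict_mem_ConQ S h₁)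
      (restrict_mem_ConQ S h₂) ?_).imp
      (fun h' => hmax _ h₁ h' (e ▸ Set.inter_subset_left))
      (fun h' => hmax _ h₂ h' (e ▸ Set.inter_subset_right))
    rw [e] at hle
    exact hle
  obtain ⟨D, hD, f, -, rfl⟩ := exists_RFSI_quotient hQ hirr
  obtain ⟨N, hN, g, rfl⟩ := hθ.1
  obtain ⟨Ψ, hΨ, hext⟩ := (h D hD).exists_extension (A := ofSub B S) hN
    (f.comp S.subtype.toHom) g fun a a' e => @hle (a, a') e
  exact ⟨_, ConQ_preimage f hΨ, Set.ext fun p => hext p.1 p.2⟩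

/-- Theorem 2.12: for a relatively congruence-distributive quasivariety `Q` with
`Q_RFSI` closed under substructures: `Q`-CEP for `Q`, EP for `Q`, `Q`-CEP for `Q_RFSI`, and EP
for `Q_RFSI` are all equivalent. -/
theorem stmt11 (L : FirstOrder.Language.{u, u}) [L.IsAlgebraic]
    (Q : Set (Struc L)) (hQ : IsQuasivariety L Q) (hd : RelCongDist Q)
    (hs : SubClosed (RFSI Q)) :
    List.TFAE [ClassQCEP Q Q, HasEP Q, ClassQCEP Q (RFSI Q), HasEP (RFSI Q)] := by
  tfae_have 1 → 2 := HasEP.of_classQCEP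
  tfae_have 2 → 1 := HasEP.classQCEP hQ subset_rfl (fun _ h => h.1) hQ.2.1
  tfae_have 1 → 3 := fun h B hB => h B hB.1
  tfae_have 3 → 1 := ClassQCEP.of_RFSI hQ hd
  tfae_have 3 → 4 := HasEP.of_classQCEP_RFSI hQ
  tfae_have 4 → 3 := HasEP.classQCEP hQ (fun _ h => h.1) subset_rfl hs
  tfae_finish

end Transfer
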